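/- arXiv:2212.09876 — 2 statements merged into one kernel-verified Lean document; each statement's English description precedes it below -/
import Mathlib

section
/- Let k be a natural number and let D be an oriented graph with minimum pseudo-semidegree strictly greater than k/2. If D contains an antidirected cycle of length m + 1 with m < k, then D contains an antidirected path of length m + 1. -/
/-- Out-degree of `v` in the digraph given by the edge relation `D`. -/
noncomputable def outDeg {V : Type*} (D : V → V → Prop) (v : V) : ℕ := {w | D v w}.ncard

/-- In-degree of `v` in the digraph given by the edge relation `D`. -/
noncomputable def inDeg {V : Type*} (D : V → V → Prop) (v : V) : ℕ := {w | D w v}.ncard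

/-- `D` is an oriented graph: for each pair of vertices, at most one of the edges
`uv`, `vu` is present (in particular there are no loops). -/
def IsOriented {V : Type*} (D : V → V → Prop) : Prop := ∀ u v, D u v → ¬ D v u

/-- The number of (directed) edges of the digraph `D`. -/
noncomputable def edgeCount {V : Type*} (D : V → V → Prop) : ℕ := {p : V × V | D p.1 p.2}.ncard

/-- The minimum pseudo-semidegree of `D` is at least `x`: `D` has an edge, and every
vertex has out-degree `0` or at least `x`, and in-degree `0` or at least `x`. -/
def PseudoGE {V : Type*} (D : V → V → Prop) (x : ℝ) : Prop :=
  (∃ u v, D u v) ∧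
    ∀ v, (outDeg D v = 0 ∨ x ≤ (outDeg D v : ℝ)) ∧ (inDeg D v = 0 ∨ x ≤ (inDeg D v : ℝ))

/-- The minimum pseudo-semidegree of `D` is strictly greater than `x`. -/
def PseudoGT {V : Type*} (D : V → V → Prop) (x : ℝ) : Prop :=
  (∃ u v, D u v) ∧
    ∀ v, (outDeg D v = 0 ∨ x < (outDeg D v : ℝ)) ∧ (inDeg D v = 0 ∨ x < (inDeg D v : ℝ))

/-- `f, g` describe an antidirected path `f 0, f 1, ..., f m` (of length `m`) in `D`:
`g i = true` iff the `i`-th edge is directed from `f i` towards `f (i+1)`, and consecutive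
edges alternate in direction (equivalently, every vertex of the path has out-degree `0`
or in-degree `0` on the path). -/
def IsAntipath {V : Type*} (D : V → V → Prop) (m : ℕ) (f : ℕ → V) (g : ℕ → Bool) : Prop :=
  Set.InjOn f (Set.Iic m) ∧
  (∀ i < m, if g i then D (f i) (f (i + 1)) else D (f (i + 1)) (f i)) ∧
  (∀ i, i + 1 < m → g i ≠ g (i + 1))

/-- `D` contains each of the (at most two) antidirected paths of length `k`:
for each initial direction `b` there is an antidirected path of length `k`
whose first edge has direction `b`. -/
def ContainsAllAntipaths {V : Type*} (D : V → V → Prop) (k : ℕ) : Prop :=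
  ∀ b : Bool, ∃ f g, IsAntipath D k f g ∧ g 0 = b

/-- `f` describes an antidirected cycle of length `n` in `D`: the `i`-th edge joins
`f i` and `f (i+1)` and is directed from `f i` iff `g i = true`; every vertex `f i`
has out-degree `0` on the cycle (i.e. `g i = false ∧ g (i-1) = true`) or in-degree `0`
on the cycle (i.e. `g i = true ∧ g (i-1) = false`). -/
def IsAnticycle {V : Type*} (D : V → V → Prop) (n : ℕ) [NeZero n] (f : ZMod n → V) : Prop :=
  3 ≤ n ∧ Function.Injective f ∧
  ∃ g : ZMod n → Bool,
    (∀ i, if g i then D (f i) (f (i + 1)) else D (f (i + 1)) (f i)) ∧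
    (∀ i : ZMod n, (g i = false ∧ g (i - 1) = true) ∨ (g i = true ∧ g (i - 1) = false))

/-- `F 0, F 1, ..., F (n - 1)` is an antidirected cycle of even length `n` whose sources
are the vertices with even index. -/
structure IsAltCycle {V : Type*} (D : V → V → Prop) (n : ℕ) (F : ℕ → V) : Prop where
  inj : ∀ i < n, ∀ j < n, F i = F j → i = j
  even : Even n
  fwd : ∀ i, Even i → i + 1 < n → D (F i) (F (i + 1))
  bwd : ∀ i, Odd i → i + 1 < n → D (F (i + 1)) (F i)
  close : D (F 0) (F (n - 1))

/-- An antidirected path whose sinks are the vertices with even index. -/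
theorem isAntipath_of_parity {V : Type*} {D : V → V → Prop} {n : ℕ} {p : ℕ → V}
    (hinj : ∀ i ≤ n, ∀ j ≤ n, p i = p j → i = j)
    (hodd : ∀ i < n, Odd i → D (p i) (p (i + 1)))
    (heven : ∀ i < n, Even i → D (p (i + 1)) (p i)) :
    IsAntipath D n p (fun i => decide (Odd i)) := by
  refine ⟨fun i hi j hj h => hinj i hi j hj h, fun i hi => ?_, fun i _ => ?_⟩
  · by_cases h : Odd i
    · simpa [h] using hodd i hi h
    · simpa [h] using heven i hi (Nat.not_odd_iff_even.1 h)
  · by_cases h : Odd i <;> simp [h, Nat.odd_add_one]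

theorem IsAntipath.of_flip {V : Type*} {D : V → V → Prop} {n : ℕ} {p : ℕ → V} {g : ℕ → Bool}
    (h : IsAntipath (flip D) n p g) : IsAntipath D n p (fun i => !g i) := by
  refine ⟨h.1, fun i hi => ?_, fun i hi => ?_⟩
  · have := h.2.1 i hi
    cases hg : g i <;> simpa [hg, flip] using this
  · simpa using h.2.2 i hi

/-- If a source of an antidirected cycle has an out-neighbour off the cycle, then opening the
cycle there gives an antidirected path of the same length. -/
theorem IsAltCycle.exists_antipath_of_exit {V : Type*} {D : V → V → Prop} {n : ℕ} {F : ℕ → V}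
    (h : IsAltCycle D n F) {w : V} (hw : D (F 0) w) (hwF : ∀ i < n, w ≠ F i) :
    ∃ p g, IsAntipath D n p g := by
  refine ⟨fun i => if i = 0 then w else F (i - 1), _,
    isAntipath_of_parity ?_ ?_ ?_⟩
  · intro i hi j hj hij
    rcases i with _ | i <;> rcases j with _ | j
    · rfl
    · exact absurd (by simpa using hij) (hwF j (by omega))
    · exact absurd (by simpa using hij.symm) (hwF i (by omega))
    · have := h.inj i (by omega) j (by omega) (by simpa using hij)
      omega
  · intro i hi ho
    rcases i with _ | i
    · simp at ho
    · simpa using h.fwd i (by grind) hi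
  · intro i hi ho
    rcases i with _ | i
    · simpa using hw
    · simpa using h.bwd i (by grind) hi

/-- Two chords of an antidirected cycle, together with two vertices off the cycle, give an
antidirected path covering all but one vertex of the cycle. -/
theorem IsAltCycle.exists_antipath_of_chords {V : Type*} {D : V → V → Prop} {n : ℕ} {F : ℕ → V}
    (h : IsAltCycle D n F) {c : ℕ} (hc : 1 ≤ c) (hcn : 2 * c < n)
    (hchord : D (F (2 * c)) (F 0)) (hchord' : D (F (2 * c - 2)) (F (n - 1))) {w w' : V}
    (hw : D w (F 0)) (hw' : D w w') (hne : w ≠ w')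
    (hwF : ∀ i < n, w ≠ F i) (hwF' : ∀ i < n, w' ≠ F i) :
    ∃ p g, IsAntipath D n p g := by
  obtain ⟨r, hr⟩ := h.even
  set q : ℕ → ℕ := fun i => if i = 2 then 0 else
    if i ≤ n - 2 * c + 2 then i + 2 * c - 3 else n + 1 - i with hq
  have hqlt : ∀ i, 2 ≤ i → i ≤ n → q i < n := by
    intro i h1 h2
    simp only [hq]
    split_ifs <;> omega
  have hqinj : ∀ i, 2 ≤ i → i ≤ n → ∀ j, 2 ≤ j → j ≤ n → q i = q j → i = j := by
    intro i h1 h2 j h3 h4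
    simp only [hq]
    split_ifs <;> omega
  set p : ℕ → V := fun i => if i = 0 then w' else if i = 1 then w else F (q i) with hp
  have hp0 : p 0 = w' := by simp [hp]
  have hp1 : p 1 = w := by simp [hp]
  have hpF : ∀ i, p (i + 2) = F (q (i + 2)) := fun i => by simp [hp]
  have hq2 : q 2 = 0 := by simp [hq]
  have hq3 : q 3 = 2 * c := by simp [hq]; omega
  refine ⟨p, _, isAntipath_of_parity ?_ ?_ ?_⟩
  · intro i hi j hj hij
    rcases i with _ | _ | i <;> rcases j with _ | _ | j <;>
      simp only [zero_add, hp0, hp1, hpF] at hij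
    · rfl
    · exact absurd hij.symm hne
    · exact absurd hij (hwF' _ (hqlt _ (by omega) hj))
    · exact absurd hij hne
    · rfl
    · exact absurd hij (hwF _ (hqlt _ (by omega) hj))
    · exact absurd hij.symm (hwF' _ (hqlt _ (by omega) hi))
    · exact absurd hij.symm (hwF _ (hqlt _ (by omega) hi))
    · exact hqinj _ (by omega) hi _ (by omega) hj
        (h.inj _ (hqlt _ (by omega) hi) _ (hqlt _ (by omega) hj) hij)
  · intro i hi ho
    rcases i with _ | _ | i
    · simp at ho
    · simpa [hp1, hpF, hq2] using hw
    · rw [show i + 2 + 1 = (i + 1) + 2 by ring, hpF, hpF]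
      rw [Nat.odd_iff] at ho
      by_cases h1 : i + 2 + 1 ≤ n - 2 * c + 2
      · have e1 : q (i + 2) = i + 2 + 2 * c - 3 := by simp only [hq]; split_ifs <;> omega
        have e2 : q (i + 1 + 2) = q (i + 2) + 1 := by
          rw [e1]; simp only [hq]; split_ifs <;> omega
        rw [e2]
        exact h.fwd _ (by rw [Nat.even_iff]; omega) (by omega)
      · have e1 : q (i + 2) = q (i + 1 + 2) + 1 := by
          simp only [hq]; split_ifs <;> omega
        have e2 : q (i + 1 + 2) = n - 2 - i := by
          simp only [hq]; split_ifs <;> omega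
        rw [e1]
        exact h.bwd _ (by rw [Nat.odd_iff]; omega) (by omega)
  · intro i hi ho
    rcases i with _ | _ | i
    · simpa [hp0, hp1] using hw'
    · simp at ho
    · rw [show i + 2 + 1 = (i + 1) + 2 by ring, hpF, hpF]
      rw [Nat.even_iff] at ho
      rcases Nat.eq_zero_or_pos i with rfl | hi0
      · simpa [hq2, hq3] using hchord
      rcases lt_trichotomy (i + 2) (n - 2 * c + 2) with h1 | h1 | h1
      · have e1 : q (i + 2) = i + 2 + 2 * c - 3 := by simp only [hq]; split_ifs <;> omega
        have e2 : q (i + 1 + 2) = q (i + 2) + 1 := by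
          rw [e1]; simp only [hq]; split_ifs <;> omega
        rw [e2]
        exact h.bwd _ (by rw [Nat.odd_iff]; omega) (by omega)
      · have e1 : q (i + 2) = n - 1 := by simp only [hq]; split_ifs <;> omega
        have e2 : q (i + 1 + 2) = 2 * c - 2 := by simp only [hq]; split_ifs <;> omega
        rw [e1, e2]
        exact hchord'
      · have e1 : q (i + 2) = q (i + 1 + 2) + 1 := by
          simp only [hq]; split_ifs <;> omega
        have e2 : q (i + 1 + 2) = n - 2 - i := by
          simp only [hq]; split_ifs <;> omega
        rw [e1]
        exact h.fwd _ (by rw [Nat.even_iff]; omega) (by omega)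

theorem alternating_add_natCast {n : ℕ} {g : ZMod n → Bool} (hg : ∀ i, g (i + 1) = !g i)
    (a : ZMod n) (i : ℕ) : g (a + i) = if Even i then g a else !g a := by
  induction i with
  | zero => simp
  | succ i ih =>
    rw [Nat.cast_add, Nat.cast_one, ← add_assoc, hg, ih]
    by_cases h : Even i <;> simp [h, Nat.even_add_one]

/-- Reading an antidirected cycle from one of its sources. -/
theorem isAltCycle_of_source {V : Type*} {D : V → V → Prop} {n : ℕ} [NeZero n] {f : ZMod n → V}
    {g : ZMod n → Bool} (hf : Function.Injective f)
    (hD : ∀ i, if g i then D (f i) (f (i + 1)) else D (f (i + 1)) (f i))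
    (hg : ∀ i, g (i + 1) = !g i) {a : ZMod n} (ha : g a = true) :
    IsAltCycle D n (fun i => f (a + i)) := by
  have key := alternating_add_natCast hg a
  refine ⟨fun i hi j hj hij => ?_, ?_, fun i hi _ => ?_, fun i hi _ => ?_, ?_⟩
  · have := add_left_cancel (hf hij)
    rw [ZMod.natCast_eq_natCast_iff] at this
    exact Nat.ModEq.eq_of_lt_of_lt this hi hj
  · by_contra hn
    have := key n
    simp [hn] at this
  · have h1 := hD (a + i)
    rw [key i] at h1
    simpa [hi, ha, add_assoc] using h1
  · have h1 := hD (a + i)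
    rw [key i] at h1
    simpa [Nat.not_even_iff_odd.2 hi, ha, add_assoc] using h1
  · have h1 := hD (a - 1)
    have h2 := hg (a - 1)
    rw [sub_add_cancel, ha] at h2
    have h3 : g (a - 1) = false := by simpa using h2.symm
    have h4 : ((n - 1 : ℕ) : ZMod n) = -1 := by
      rw [Nat.cast_sub (NeZero.one_le)]; simp
    simp only [h4]
    rw [h3, sub_add_cancel] at h1
    simpa [sub_eq_add_neg] using h1

/-- In an alternating cyclic sequence exactly half of the entries are `true`. -/
theorem two_mul_card_filter_alternating {n : ℕ} [NeZero n] {g : ZMod n → Bool}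
    (hg : ∀ i, g (i + 1) = !g i) :
    2 * (Finset.univ.filter (fun i => g i = true)).card = n := by
  have h1 : (Finset.univ.filter (fun i => g i = true)).card =
      (Finset.univ.filter (fun i => ¬ g i = true)).card := by
    refine Finset.card_equiv (Equiv.addRight 1) fun i => ?_
    simp [hg]
  have h2 := Finset.card_filter_add_card_filter_not (s := (Finset.univ : Finset (ZMod n)))
    (fun i => g i = true)
  rw [Finset.card_univ, ZMod.card] at h2
  omega

/-- If every source of an antidirected cycle of length `n` sends more than `n / 2` edges to the
cycle, then two of these edges form a pair of crossing chords. -/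
theorem exists_crossing_chords {n : ℕ} [NeZero n] {g : ZMod n → Bool}
    (hg : ∀ i, g (i + 1) = !g i) (hne : ∃ a, g a = true) (E : ZMod n → ZMod n → Prop)
    [∀ a, DecidablePred (E a)]
    (hE : ∀ a, g a = true → n < 2 * (Finset.univ.filter (fun j => E a j)).card) :
    ∃ b a, g b = true ∧ g a = true ∧ E b a ∧ E (b - 2) (a - 1) := by
  set S := Finset.univ.filter (fun i => g i = true) with hS
  have hcard : 2 * S.card = n := two_mul_card_filter_alternating hg
  have hg' : ∀ i, g (i - 1) = !g i := fun i => by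
    have := hg (i - 1)
    rw [sub_add_cancel] at this
    simp [this]
  have hg2 : ∀ i, g (i - 2) = g i := fun i => by
    rw [show i - 2 = i - 1 - 1 by ring, hg', hg', Bool.not_not]
  set P : ZMod n → ℕ := fun b => (S.filter (fun j => E b j)).card with hP
  set Q : ZMod n → ℕ := fun b => (S.filter (fun j => E b (j - 1))).card with hQ
  have hsplit : ∀ b, P b + Q b = (Finset.univ.filter (fun j => E b j)).card := by
    intro b
    rw [← Finset.card_filter_add_card_filter_not (s := Finset.univ.filter (fun j => E b j))
      (fun i => g i = true)]
    congr 1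
    · simp only [hP, hS, Finset.filter_filter, and_comm]
    · refine Finset.card_equiv (Equiv.subRight 1) fun i => ?_
      simp [hS, hg', and_comm]
  have hshift : ∑ b ∈ S, Q (b - 2) = ∑ b ∈ S, Q b :=
    Finset.sum_equiv (Equiv.subRight 2) (fun i => by simp [hS, hg2]) (fun i _ => rfl)
  have hSne : S.Nonempty := by
    obtain ⟨a, ha⟩ := hne
    exact ⟨a, by simp [hS, ha]⟩
  obtain ⟨b, hb, hlt⟩ : ∃ b ∈ S, S.card < P b + Q (b - 2) := by
    refine Finset.exists_lt_of_sum_lt ?_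
    rw [Finset.sum_add_distrib, hshift, ← Finset.sum_add_distrib]
    refine Finset.sum_lt_sum_of_nonempty hSne fun b hb => ?_
    have := hE b (by simpa [hS] using hb)
    rw [hsplit]
    omega
  obtain ⟨a, ha⟩ : (S.filter (fun j => E b j) ∩ S.filter (fun j => E (b - 2) (j - 1))).Nonempty :=
    Finset.inter_nonempty_of_card_lt_card_add_card (Finset.filter_subset _ _)
      (Finset.filter_subset _ _) hlt
  simp only [Finset.mem_inter, Finset.mem_filter] at ha
  exact ⟨b, a, by simpa [hS] using hb, by simpa [hS] using ha.1.1, ha.1.2, ha.2.2⟩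

theorem PseudoGT.lt_two_mul_outDeg {V : Type*} [Finite V] {D : V → V → Prop} {k : ℕ}
    (h : PseudoGT D ((k : ℝ) / 2)) {u v : V} (huv : D u v) : k < 2 * outDeg D u := by
  rcases (h.2 u).1 with h0 | h1
  · have h2 : ({w | D u w} : Set V) = ∅ := (Set.ncard_eq_zero (Set.toFinite _)).1 h0
    exact absurd (show v ∈ {w | D u w} from huv) (by simp [h2])
  · have : (k : ℝ) < 2 * (outDeg D u : ℝ) := by linarith
    exact_mod_cast this

theorem PseudoGT.flip {V : Type*} {D : V → V → Prop} {x : ℝ} (h : PseudoGT D x) :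
    PseudoGT (flip D) x :=
  ⟨let ⟨u, v, huv⟩ := h.1; ⟨v, u, huv⟩, fun v => ⟨(h.2 v).2, (h.2 v).1⟩⟩

theorem PseudoGT.lt_two_mul_inDeg {V : Type*} [Finite V] {D : V → V → Prop} {k : ℕ}
    (h : PseudoGT D ((k : ℝ) / 2)) {u v : V} (huv : D u v) : k < 2 * inDeg D v :=
  h.flip.lt_two_mul_outDeg (D := _root_.flip D) huv

/-- Lemma 3: if `D` is an oriented graph of minimum pseudo-semidegree strictly greater
than `k/2` containing an antidirected cycle of length `m + 1` with `m < k`, then `D`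
contains an antidirected path of length `m + 1`. -/
theorem stmt_6 {V : Type*} [Fintype V] (D : V → V → Prop) (hor : IsOriented D)
    (k m : ℕ) (hps : PseudoGT D ((k : ℝ) / 2))
    (hcycle : ∃ f : ZMod (m + 1) → V, IsAnticycle D (m + 1) f)
    (hmk : m < k) :
    ∃ f g, IsAntipath D (m + 1) f g := by
  classical
  obtain ⟨f, -, hf, g, hD, hg0⟩ := hcycle
  have hg : ∀ i, g (i + 1) = !g i := fun i => by
    have := hg0 (i + 1)
    rw [add_sub_cancel_right] at this
    rcases this with ⟨h1, h2⟩ | ⟨h1, h2⟩ <;> simp [h1, h2]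
  by_contra hno
  have hout : ∀ a, g a = true → ∀ w, D (f a) w → w ∈ Set.range f := by
    intro a ha w hw
    by_contra hwf
    exact hno ((isAltCycle_of_source hf hD hg ha).exists_antipath_of_exit (w := w)
      (by simpa using hw) fun i _ h => hwf ⟨_, h.symm⟩)
  have hin : ∀ a, g a = false → ∀ w, D w (f a) → w ∈ Set.range f := by
    intro a ha w hw
    by_contra hwf
    have hD' : ∀ i, if !g i then flip D (f i) (f (i + 1)) else flip D (f (i + 1)) (f i) := by
      intro i
      have := hD i
      cases h : g i <;> simpa [h, flip] using this
    obtain ⟨p, g', hp⟩ := (isAltCycle_of_source (g := fun i => !g i) hf hD' (by simp [hg])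
      (a := a) (by simp [ha])).exists_antipath_of_exit (w := w)
      (by simpa [flip] using hw) fun i _ h => hwf ⟨_, h.symm⟩
    exact hno ⟨p, _, hp.of_flip⟩
  have hdeg : ∀ a, g a = true →
      m + 1 < 2 * (Finset.univ.filter (fun j => D (f a) (f j))).card := by
    intro a ha
    have h1 : k < 2 * outDeg D (f a) :=
      hps.lt_two_mul_outDeg (v := f (a + 1)) (by simpa [ha] using hD a)
    have h2 : {w | D (f a) w} = ((Finset.univ.filter (fun j => D (f a) (f j))).image f : Set V) := by
      ext w
      simp only [Set.mem_ofPred_eq, Finset.coe_image, Finset.coe_filter, Finset.mem_univ, true_and,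
        Set.mem_image]
      constructor
      · intro hw
        obtain ⟨j, rfl⟩ := hout a ha w hw
        exact ⟨j, hw, rfl⟩
      · rintro ⟨j, hj, rfl⟩
        exact hj
    rw [outDeg, h2, Set.ncard_coe_finset,
      Finset.card_image_of_injective _ hf] at h1
    omega
  have hsrc : ∃ a, g a = true := by
    by_contra! h
    have := hg 0
    rw [Bool.eq_false_iff.2 (h (0 + 1)), Bool.eq_false_iff.2 (h 0)] at this
    simp at this
  obtain ⟨b, a, hb, ha, hba, hba'⟩ := exists_crossing_chords hg hsrc (fun i j => D (f i) (f j)) hdeg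
  obtain ⟨w, hw, hwf⟩ : ∃ w, D w (f a) ∧ w ∉ Set.range f := by
    by_contra! h
    have h1 : k < 2 * inDeg D (f a) := hps.lt_two_mul_inDeg hba
    have h2 : k < 2 * outDeg D (f a) :=
      hps.lt_two_mul_outDeg (v := f (a + 1)) (by simpa [ha] using hD a)
    have h3 : outDeg D (f a) + inDeg D (f a) ≤ (Set.range f).ncard := by
      rw [outDeg, inDeg, ← Set.ncard_union_eq _ (Set.toFinite _) (Set.toFinite _)]
      · refine Set.ncard_le_ncard ?_ (Set.toFinite _)
        rintro x (hx | hx)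
        · exact hout a ha x hx
        · exact h x hx
      · rw [Set.disjoint_left]
        exact fun x hx hx' => hor _ _ hx hx'
    have h4 : (Set.range f).ncard = m + 1 := by
      rw [Set.ncard_range_of_injective hf, Nat.card_zmod]
    omega
  obtain ⟨w', hw', hwf'⟩ : ∃ w', D w w' ∧ w' ∉ Set.range f := by
    by_contra! h
    have h1 : k < 2 * outDeg D w := hps.lt_two_mul_outDeg hw
    have h2 : {x | D w x} ⊆ ((Finset.univ.filter (fun i => g i = true)).image f : Finset V) := by
      intro x hx
      obtain ⟨j, rfl⟩ := h x hx
      cases hj : g j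
      · exact absurd (hin j hj w hx) hwf
      · simp only [Finset.coe_image]
        exact ⟨j, by simp [hj], rfl⟩
    have h3 := Set.ncard_le_ncard h2 (Set.toFinite _)
    rw [Set.ncard_coe_finset, Finset.card_image_of_injective _ hf] at h3
    have h4 := two_mul_card_filter_alternating hg
    rw [outDeg] at h1
    omega
  have hcyc := isAltCycle_of_source hf hD hg ha
  have hd : a + ((b - a).val : ℕ) = b := by rw [ZMod.natCast_zmod_val]; ring
  have hlt := ZMod.val_lt (b - a)
  have heven : Even (b - a).val := by
    by_contra h
    have := alternating_add_natCast hg a (b - a).val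
    rw [hd, if_neg h, ha, hb] at this
    simp at this
  obtain ⟨c, hc⟩ := heven
  rw [← two_mul] at hc
  rw [hc] at hd hlt
  have hc0 : 1 ≤ c := by
    rcases Nat.eq_zero_or_pos c with rfl | h
    · have : a = b := by simpa using hd
      subst this
      exact absurd hba (hor _ _ hba)
    · exact h
  refine hno (hcyc.exists_antipath_of_chords hc0 hlt ?_ ?_ (w := w) (w' := w') ?_ hw' ?_ ?_ ?_)
  · simpa only [hd, Nat.cast_zero, add_zero] using hba
  · have e1 : a + ((2 * c - 2 : ℕ) : ZMod (m + 1)) = b - 2 := by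
      rw [Nat.cast_sub (by omega), ← hd]; push_cast; ring
    have e2 : a + ((m + 1 - 1 : ℕ) : ZMod (m + 1)) = a - 1 := by
      rw [Nat.cast_sub (by omega), ZMod.natCast_self]; simp [sub_eq_add_neg]
    simp only [e1, e2]
    exact hba'
  · simpa using hw
  · rintro rfl
    exact hor _ _ hw' hw'
  · exact fun i _ h => hwf ⟨_, h.symm⟩
  · exact fun i _ h => hwf' ⟨_, h.symm⟩
end

section
/- Let k ≥ 3 be a natural number and let D be an oriented graph with minimum pseudo-semidegree at least (3k-2)/4. Then D contains every antidirected path of length k. -/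
open Finset

/-- `f 0, ..., f m` is an antidirected path of length `m` in `D` in which exactly the vertices
with even index are sources. -/
def OutPath {V : Type*} (D : V → V → Prop) (m : ℕ) (f : ℕ → V) : Prop :=
  Set.InjOn f (Set.Iic m) ∧
    ∀ i j, i ≤ m → j ≤ m → Even i → (j = i + 1 ∨ i = j + 1) → D (f i) (f j)

/-- The sources of an `OutPath`. -/
noncomputable def sources {V : Type*} (m : ℕ) (f : ℕ → V) : Finset V :=
  open Classical in ((range (m + 1)).filter Even).image f

/-- The sinks of an `OutPath`. -/
noncomputable def sinks {V : Type*} (m : ℕ) (f : ℕ → V) : Finset V :=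
  open Classical in ((range (m + 1)).filter (¬ Even ·)).image f

/-- The out-neighbourhood of a vertex, as a finset. -/
noncomputable def outNbrs {V : Type*} [Fintype V] (D : V → V → Prop) (v : V) : Finset V :=
  open Classical in univ.filter (D v)

section Paths

variable {V : Type*} {D : V → V → Prop} {m : ℕ} {f : ℕ → V}

theorem IsOriented.reverse (hor : IsOriented D) : IsOriented (flip D) := fun u v h => hor v u h

theorem mem_sources {x : V} : x ∈ sources m f ↔ ∃ i ≤ m, Even i ∧ f i = x := by
  simp [sources, and_assoc]

theorem mem_sinks {x : V} : x ∈ sinks m f ↔ ∃ i ≤ m, ¬ Even i ∧ f i = x := by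
  simp [sinks, and_assoc]

theorem card_filter_even_range (m : ℕ) : #((range (m + 1)).filter Even) = m / 2 + 1 := by
  induction m with
  | zero => rfl
  | succ m ih =>
    rw [range_add_one, filter_insert]
    split_ifs with h
    · rw [card_insert_of_notMem (by simp), ih]; grind
    · rw [ih]; grind

theorem OutPath.card_sources (h : OutPath D m f) : #(sources m f) = m / 2 + 1 := by
  classical
  rw [sources, card_image_of_injOn, card_filter_even_range]
  intro i hi j hj hij
  simp at hi hj
  exact h.1 (Set.mem_Iic.2 (by lia)) (Set.mem_Iic.2 (by lia)) hij

theorem OutPath.card_sinks (h : OutPath D m f) : #(sinks m f) = (m + 1) / 2 := by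
  classical
  rw [sinks, card_image_of_injOn]
  · have h1 := card_filter_add_card_filter_not (s := range (m + 1)) Even
    rw [card_filter_even_range, card_range] at h1
    lia
  · intro i hi j hj hij
    simp at hi hj
    exact h.1 (Set.mem_Iic.2 (by lia)) (Set.mem_Iic.2 (by lia)) hij

theorem OutPath.notMem_sinks (h : OutPath D m f) {x : V} (hx : x ∈ sources m f) :
    x ∉ sinks m f := by
  rw [mem_sources] at hx
  rw [mem_sinks]
  rintro ⟨j, hj, hj', e⟩
  obtain ⟨i, hi, hi', rfl⟩ := hx
  have := h.1 (Set.mem_Iic.2 hj) (Set.mem_Iic.2 hi) e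
  grind

theorem outPath_zero (D : V → V → Prop) (x : V) : OutPath D 0 (fun _ => x) := by
  refine ⟨?_, ?_⟩
  · intro i hi j hj _
    simp at hi hj
    lia
  · intro i j hi hj _ hij
    lia

/-- A new sink may be prepended to a path which starts at a source. -/
theorem OutPath.cons (h : OutPath D m f) {x : V} (hx : ∀ i ≤ m, f i ≠ x) (hD : D (f 0) x) :
    OutPath (flip D) (m + 1) (fun i => Nat.casesOn i x f) := by
  refine ⟨?_, ?_⟩
  · rintro (_ | i) hi (_ | j) hj hij
    · rfl
    · exact absurd hij.symm (hx j (by simpa using hj))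
    · exact absurd hij (hx i (by simpa using hi))
    · simp only [Set.mem_Iic] at hi hj
      rw [h.1 (Set.mem_Iic.2 (by lia)) (Set.mem_Iic.2 (by lia)) hij]
  · rintro (_ | i) (_ | j) hi hj he hij
    · lia
    · obtain rfl : j = 0 := by lia
      exact hD
    · exact absurd he (by simp_all)
    · exact h.2 j i (by lia) (by lia) (by grind) (by lia)

theorem OutPath.reverse_even (h : OutPath D m f) (hm : Even m) :
    OutPath D m (fun i => f (m - i)) := by
  refine ⟨?_, ?_⟩
  · intro i hi j hj hij
    simp only [Set.mem_Iic] at hi hj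
    have := h.1 (Set.mem_Iic.2 (by lia)) (Set.mem_Iic.2 (by lia)) hij
    lia
  · intro i j hi hj he hij
    exact h.2 _ _ (by lia) (by lia) (by grind) (by lia)

theorem OutPath.reverse_odd (h : OutPath D m f) (hm : ¬ Even m) :
    OutPath (flip D) m (fun i => f (m - i)) := by
  refine ⟨?_, ?_⟩
  · intro i hi j hj hij
    simp only [Set.mem_Iic] at hi hj
    have := h.1 (Set.mem_Iic.2 (by lia)) (Set.mem_Iic.2 (by lia)) hij
    lia
  · intro i j hi hj he hij
    exact h.2 _ _ (by lia) (by lia) (by grind) (by lia)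

/-- Rotation of a path at an edge from its first vertex to a sink. -/
theorem OutPath.rotate (h : OutPath D m f) {i : ℕ} (hi : i ≤ m) (ho : ¬ Even i)
    (hD : D (f 0) (f i)) :
    ∃ g, OutPath D m g ∧ g 0 = f (i - 1) ∧ sources m g = sources m f ∧ sinks m g = sinks m f := by
  have hi0 : 0 < i := by grind
  refine ⟨fun j => f (if j < i then i - 1 - j else j), ⟨?_, ?_⟩, by simp [hi0], ?_, ?_⟩
  · intro j hj l hl hjl
    simp only [Set.mem_Iic] at hj hl
    have := h.1 (Set.mem_Iic.2 (by split_ifs <;> lia)) (Set.mem_Iic.2 (by split_ifs <;> lia)) hjl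
    split_ifs at this <;> lia
  · intro j l hj hl he hjl
    dsimp only
    split_ifs with h1 h2 h2
    · exact h.2 _ _ (by lia) (by lia) (by grind) (by lia)
    · have e1 : i - 1 - j = 0 := by lia
      have e2 : l = i := by lia
      rw [e1, e2]
      exact hD
    · exact absurd he (by grind)
    · exact h.2 _ _ (by lia) (by lia) (by grind) (by lia)
  · ext x
    simp only [mem_sources]
    constructor
    · rintro ⟨j, hj, he, rfl⟩
      exact ⟨_, by split_ifs <;> lia, by split_ifs <;> grind, rfl⟩
    · rintro ⟨j, hj, he, rfl⟩
      refine ⟨if j < i then i - 1 - j else j, by split_ifs <;> lia, by split_ifs <;> grind, ?_⟩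
      congr 1
      split_ifs <;> lia
  · ext x
    simp only [mem_sinks]
    constructor
    · rintro ⟨j, hj, he, rfl⟩
      exact ⟨_, by split_ifs <;> lia, by split_ifs <;> grind, rfl⟩
    · rintro ⟨j, hj, he, rfl⟩
      refine ⟨if j < i then i - 1 - j else j, by split_ifs <;> lia, by split_ifs <;> grind, ?_⟩
      congr 1
      split_ifs <;> lia

/-- If a path has no extension at its first vertex, then all out-neighbours of that vertex lie
on the path. -/
theorem OutPath.mem_of_maximal (h : OutPath D m f) (hno : ∀ g, ¬ OutPath (flip D) (m + 1) g)
    {y : V} (hy : D (f 0) y) : y ∈ sources m f ∨ y ∈ sinks m f := by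
  by_contra! hc
  refine hno _ (h.cons (x := y) ?_ hy)
  rintro i hi rfl
  by_cases he : Even i
  · exact hc.1 (mem_sources.2 ⟨i, hi, he, rfl⟩)
  · exact hc.2 (mem_sinks.2 ⟨i, hi, he, rfl⟩)

/-- A path starting at a sink can be prolonged through a complete bipartite piece `A → B`. -/
theorem OutPath.prolong [DecidableEq V] {A B : Finset V} (hAB : Disjoint A B)
    (hD : ∀ a ∈ A, ∀ b ∈ B, D a b) (r : ℕ) (hA : r ≤ #A) (hB : r ≤ #B)
    (h : OutPath (flip D) m f) (h0 : ∀ a ∈ A, D a (f 0)) (hf : ∀ i ≤ m, f i ∉ A ∧ f i ∉ B) :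
    ∃ g, OutPath (flip D) (m + 2 * r) g := by
  induction r generalizing m f A B with
  | zero => exact ⟨f, h⟩
  | succ r ih =>
    obtain ⟨a, ha⟩ : A.Nonempty := card_pos.1 (by lia)
    obtain ⟨b, hb⟩ : B.Nonempty := card_pos.1 (by lia)
    have h1 : OutPath D (m + 1) _ := h.cons (x := a) (fun i hi e => (hf i hi).1 (e ▸ ha)) (h0 a ha)
    have hab : a ≠ b := fun e => disjoint_left.1 hAB ha (e ▸ hb)
    have h2 := h1.cons (x := b) (by
      rintro (_ | i) hi
      · exact hab
      · exact (ne_of_mem_of_not_mem hb (hf i (by lia)).2).symm) (hD a ha b hb)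
    obtain ⟨g, hg⟩ := ih (A := A.erase a) (B := B.erase b)
      (hAB.mono (erase_subset _ _) (erase_subset _ _))
      (fun x hx y hy => hD x (mem_of_mem_erase hx) y (mem_of_mem_erase hy))
      (by rw [card_erase_of_mem ha]; lia) (by rw [card_erase_of_mem hb]; lia) h2
      (fun x hx => hD x (mem_of_mem_erase hx) b hb) (by
        rintro (_ | _ | i) hi
        · exact ⟨fun hh => disjoint_left.1 hAB (mem_of_mem_erase hh) hb, notMem_erase _ _⟩
        · exact ⟨notMem_erase _ _, fun hh => disjoint_left.1 hAB ha (mem_of_mem_erase hh)⟩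
        · exact ⟨fun hh => (hf i (by lia)).1 (mem_of_mem_erase hh),
            fun hh => (hf i (by lia)).2 (mem_of_mem_erase hh)⟩)
    exact ⟨g, by convert hg using 1; lia⟩

theorem OutPath.isAntipath (h : OutPath D m f) :
    ∃ f g, IsAntipath D m f g ∧ g 0 = true := by
  refine ⟨f, fun i => decide (Even i), ⟨h.1, ?_, ?_⟩, by simp⟩
  · intro i hi
    by_cases he : Even i
    · simpa [he] using h.2 i (i + 1) (by lia) (by lia) he (by lia)
    · simpa [he] using h.2 (i + 1) i (by lia) (by lia) (by grind) (by lia)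
  · intro i _
    by_cases he : Even i <;> simp [he, Nat.even_add_one]

theorem OutPath.isAntipath_flip (h : OutPath (flip D) m f) :
    ∃ f g, IsAntipath D m f g ∧ g 0 = false := by
  refine ⟨f, fun i => !decide (Even i), ⟨h.1, ?_, ?_⟩, by simp⟩
  · intro i hi
    by_cases he : Even i
    · simpa [he, flip] using h.2 i (i + 1) (by lia) (by lia) he (by lia)
    · simpa [he, flip] using h.2 (i + 1) i (by lia) (by lia) (by grind) (by lia)
  · intro i _
    by_cases he : Even i <;> simp [he, Nat.even_add_one]

end Paths

section Counting

variable {V : Type*} [Fintype V] {D : V → V → Prop}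

theorem mem_outNbrs {v w : V} : w ∈ outNbrs D v ↔ D v w := by simp [outNbrs]

theorem card_outNbrs (v : V) : #(outNbrs D v) = outDeg D v := by
  rw [outDeg, ← Set.ncard_coe_finset]
  congr 1
  ext w
  simp [mem_outNbrs]

theorem IsOriented.two_mul_sum_card_le [DecidableEq V] (hor : IsOriented D) (X : Finset V) :
    2 * ∑ x ∈ X, #(outNbrs D x ∩ X) ≤ #X * (#X - 1) := by
  classical
  have h1 : ∑ x ∈ X, #(outNbrs D x ∩ X) = ∑ x ∈ X, #(outNbrs (flip D) x ∩ X) := by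
    have h := sum_card_bipartiteAbove_eq_sum_card_bipartiteBelow (s := X) (t := X) D
    convert h using 3
    · ext y; simp [mem_outNbrs, mem_bipartiteAbove, and_comm]
    · ext y; simp [mem_outNbrs, mem_bipartiteBelow, and_comm, flip]
  rw [two_mul]
  nth_rewrite 2 [h1]
  rw [← sum_add_distrib, ← smul_eq_mul, ← sum_const]
  refine sum_le_sum fun x hx => ?_
  rw [← card_union_of_disjoint, ← card_erase_of_mem hx]
  · refine card_le_card fun y hy => ?_
    simp only [mem_union, mem_inter, mem_outNbrs, flip] at hy
    rw [mem_erase]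
    refine ⟨?_, by tauto⟩
    rintro rfl
    have := hor y y
    tauto
  · rw [disjoint_left]
    intro y hy hy'
    simp only [mem_inter, mem_outNbrs, flip] at hy hy'
    exact hor _ _ hy.1 hy'.1

/-- Double counting the edges leaving `X`. -/
theorem IsOriented.two_mul_add_one_le [DecidableEq V] (hor : IsOriented D) {A B X : Finset V}
    {d : ℕ} (hXA : X ⊆ A) (hX : X.Nonempty) (hN : ∀ x ∈ X, outNbrs D x ⊆ A ∪ B)
    (hB : ∀ x ∈ X, #(outNbrs D x ∩ B) ≤ #X) (hd : ∀ x ∈ X, d ≤ #(outNbrs D x)) :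
    2 * d + 1 ≤ 2 * #A + #X ∧
      (2 * #A + #X ≤ 2 * d + 1 →
        ∀ x ∈ X, #(outNbrs D x ∩ B) = #X ∧ A \ X ⊆ outNbrs D x) := by
  have hs : 0 < #X := card_pos.2 hX
  have hAX := card_sdiff_add_card_eq_card hXA
  set c : V → ℕ := fun x => #(outNbrs D x ∩ (A \ X)) + #(outNbrs D x ∩ B) with hc
  have hcA : ∀ x, #(outNbrs D x ∩ (A \ X)) ≤ #(A \ X) := fun x => card_le_card inter_subset_right
  have hcle : ∀ x ∈ X, c x ≤ #A := fun x hx => by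
    have := hB x hx
    have := hcA x
    simp only [hc]
    lia
  have hdle : ∀ x ∈ X, d ≤ #(outNbrs D x ∩ X) + c x := fun x hx => by
    have h1 : outNbrs D x ⊆ (outNbrs D x ∩ X) ∪ ((outNbrs D x ∩ (A \ X)) ∪ (outNbrs D x ∩ B)) := by
      intro y hy
      have := hN x hx hy
      simp only [mem_union, mem_inter, mem_sdiff] at this ⊢
      tauto
    calc d ≤ _ := hd x hx
      _ ≤ _ := card_le_card h1
      _ ≤ _ := card_union_le _ _
      _ ≤ _ := Nat.add_le_add_left (card_union_le _ _) _
  have hsum := sum_le_sum hdle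
  rw [sum_const, smul_eq_mul, sum_add_distrib] at hsum
  have ht := hor.two_mul_sum_card_le X
  obtain ⟨s, hs'⟩ : ∃ s, #X = s + 1 := ⟨#X - 1, by lia⟩
  have hpred : #X - 1 = s := by lia
  rw [hpred] at ht
  refine ⟨?_, fun heq x hx => ?_⟩
  · have h2 := sum_le_sum hcle
    rw [sum_const, smul_eq_mul] at h2
    have : #X * (2 * d) ≤ #X * (s + 2 * #A) := by nlinarith
    have := Nat.le_of_mul_le_mul_left this hs
    lia
  · have hcx : c x = #A := by
      by_contra hne
      have h2 := sum_lt_sum hcle ⟨x, hx, lt_of_le_of_ne (hcle x hx) hne⟩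
      rw [sum_const, smul_eq_mul] at h2
      have : #X * (2 * d) < #X * (s + 2 * #A) := by nlinarith
      have := Nat.lt_of_mul_lt_mul_left this
      lia
    have h3 := hB x hx
    have h4 := hcA x
    simp only [hc] at hcx
    refine ⟨by lia, ?_⟩
    have := eq_of_subset_of_card_le (inter_subset_right (s₁ := outNbrs D x) (s₂ := A \ X)) (by lia)
    exact inter_eq_right.1 this

/-- The rotation-maximal path: if no path of length `m` can be extended at a source endpoint,
then some such path has a large set `X` of sources, all of which are possible endpoints. -/
theorem exists_rotation_maximal {m d : ℕ} {f₀ : ℕ → V} (hor : IsOriented D)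
    (hd : ∀ v w, D v w → d ≤ #(outNbrs D v)) (hm : 1 ≤ m) (h₀ : OutPath D m f₀)
    (hno : ∀ g, ¬ OutPath (flip D) (m + 1) g) :
    ∃ f, OutPath D m f ∧ ∃ X : Finset V,
      (∀ x ∈ X, ∃ i < m, Even i ∧ f i = x) ∧
      (∀ x ∈ X, ∀ y, D x y → y ∈ sources m f ∨ y ∈ sinks m f) ∧
      X.Nonempty ∧ #X ≤ #(sinks m f) ∧
      2 * d + 1 ≤ 2 * #(sources m f) + #X ∧
      (2 * #(sources m f) + #(sinks m f) ≤ 2 * d + 1 → #X = #(sinks m f) ∧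
        ∀ x ∈ X, (∀ y ∈ sinks m f, D x y) ∧ ∀ y ∈ sources m f, y ∉ X → D x y) := by
  classical
  set P : ℕ → Prop := fun t => ∃ f, OutPath D m f ∧ #(outNbrs D (f 0) ∩ sinks m f) = t with hP
  obtain ⟨f, hf, hfs⟩ : P (Nat.findGreatest P (Fintype.card V)) :=
    Nat.findGreatest_spec (P := P) (card_le_univ _) ⟨f₀, h₀, rfl⟩
  have hmax : ∀ g, OutPath D m g →
      #(outNbrs D (g 0) ∩ sinks m g) ≤ #(outNbrs D (f 0) ∩ sinks m f) := fun g hg => by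
    rw [hfs]
    exact Nat.le_findGreatest (card_le_univ _) ⟨g, hg, rfl⟩
  set I := (range (m + 1)).filter (fun i => ¬ Even i ∧ D (f 0) (f i)) with hI
  have hIm : ∀ i, i ∈ I ↔ i ≤ m ∧ ¬ Even i ∧ D (f 0) (f i) := fun i => by
    simp [hI]
  have hIcard : #(outNbrs D (f 0) ∩ sinks m f) = #I := by
    rw [← card_image_of_injOn (s := I) (f := f)]
    · congr 1
      ext x
      simp only [mem_inter, mem_outNbrs, mem_sinks, mem_image, hIm]
      constructor
      · rintro ⟨h1, i, h2, h3, rfl⟩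
        exact ⟨i, ⟨h2, h3, h1⟩, rfl⟩
      · rintro ⟨i, ⟨h2, h3, h1⟩, rfl⟩
        exact ⟨h1, i, h2, h3, rfl⟩
    · intro i hi j hj hij
      rw [mem_coe, hIm] at hi hj
      exact hf.1 hi.1 hj.1 hij
  set X := I.image (fun i => f (i - 1)) with hX
  have hXcard : #X = #I := by
    refine card_image_of_injOn fun i hi j hj hij => ?_
    rw [mem_coe, hIm] at hi hj
    have := hf.1 (Set.mem_Iic.2 (by lia)) (Set.mem_Iic.2 (by lia)) hij
    have : i ≠ 0 := by grind
    have : j ≠ 0 := by grind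
    lia
  have hrot : ∀ x ∈ X, ∃ g, OutPath D m g ∧ g 0 = x ∧ sources m g = sources m f ∧
      sinks m g = sinks m f := by
    intro x hx
    obtain ⟨i, hi, rfl⟩ := mem_image.1 hx
    rw [hIm] at hi
    exact hf.rotate hi.1 hi.2.1 hi.2.2
  have hXi : ∀ x ∈ X, ∃ i < m, Even i ∧ f i = x := by
    intro x hx
    obtain ⟨i, hi, rfl⟩ := mem_image.1 hx
    rw [hIm] at hi
    have : i ≠ 0 := by grind
    exact ⟨i - 1, by lia, by grind, rfl⟩
  have hXA : X ⊆ sources m f := fun x hx => by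
    obtain ⟨i, hi, he, e⟩ := hXi x hx
    exact mem_sources.2 ⟨i, hi.le, he, e⟩
  have hXne : X.Nonempty := by
    refine Finset.Nonempty.image ⟨1, (hIm 1).2 ⟨hm, by simp, ?_⟩⟩ _
    exact hf.2 0 1 (by lia) hm (by simp) (by lia)
  have hNX : ∀ x ∈ X, ∀ y, D x y → y ∈ sources m f ∨ y ∈ sinks m f := by
    intro x hx y hxy
    obtain ⟨g, hg, rfl, e1, e2⟩ := hrot x hx
    rw [← e1, ← e2]
    exact hg.mem_of_maximal hno hxy
  have hBX : ∀ x ∈ X, #(outNbrs D x ∩ sinks m f) ≤ #X := by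
    intro x hx
    obtain ⟨g, hg, rfl, -, e2⟩ := hrot x hx
    have := hmax g hg
    rwa [e2, hIcard, ← hXcard] at this
  have hdX : ∀ x ∈ X, d ≤ #(outNbrs D x) := by
    intro x hx
    obtain ⟨g, hg, rfl, -, -⟩ := hrot x hx
    exact hd _ _ (hg.2 0 1 (by lia) hm (by simp) (by lia))
  have hXle : #X ≤ #(sinks m f) := by
    rw [hXcard, ← hIcard]
    exact card_le_card inter_subset_right
  obtain ⟨hle, heq⟩ := hor.two_mul_add_one_le hXA hXne
    (fun x hx y hy => mem_union.2 (hNX x hx y (mem_outNbrs.1 hy))) hBX hdX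
  refine ⟨f, hf, X, hXi, hNX, hXne, hXle, hle, fun h => ?_⟩
  have hXs : #X = #(sinks m f) := by lia
  refine ⟨hXs, fun x hx => ?_⟩
  obtain ⟨h1, h2⟩ := heq (by lia) x hx
  refine ⟨fun y hy => ?_, fun y hy hyX => mem_outNbrs.1 (h2 (mem_sdiff.2 ⟨hy, hyX⟩))⟩
  have := eq_of_subset_of_card_le (inter_subset_right (s₁ := outNbrs D x) (s₂ := sinks m f))
    (by lia)
  exact mem_outNbrs.1 (inter_eq_right.1 this hy)

variable {d k : ℕ}

/-- Below length `k - 1`, a path can always be extended at a source endpoint. -/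
theorem exists_outPath_succ (hor : IsOriented D) (hd : ∀ v w, D v w → d ≤ #(outNbrs D v))
    (hdk : 3 * k ≤ 4 * d + 2) {m : ℕ} (hm : 1 ≤ m) (hmk : m + 1 < k)
    (h : ∃ f, OutPath D m f) : ∃ g, OutPath (flip D) (m + 1) g := by
  by_contra! hno
  obtain ⟨f₀, h₀⟩ := h
  obtain ⟨f, hf, X, -, -, -, h1, h2, -⟩ := exists_rotation_maximal hor hd hm h₀ hno
  rw [hf.card_sources] at h2
  rw [hf.card_sinks] at h1
  lia

theorem exists_outPath_of_lt (hor : IsOriented D) (hd : ∀ v w, D v w → d ≤ #(outNbrs D v))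
    (hd' : ∀ v w, flip D v w → d ≤ #(outNbrs (flip D) v))
    (hdk : 3 * k ≤ 4 * d + 2) (hedge : ∃ u v, D u v) {m : ℕ} (hm : 1 ≤ m) (hmk : m < k) :
    (∃ f, OutPath D m f) ∨ ∃ f, OutPath (flip D) m f := by
  induction m, hm using Nat.le_induction with
  | base =>
    obtain ⟨u, v, huv⟩ := hedge
    exact Or.inr ⟨_, (outPath_zero D u).cons (x := v)
      (fun _ _ e => hor u v huv (by rw [e] at huv ⊢; exact huv)) huv⟩
  | succ m hm ih =>
    rcases ih (by lia) with h | h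
    · exact Or.inr (exists_outPath_succ hor hd hdk hm hmk h)
    · exact Or.inl (exists_outPath_succ hor.reverse hd' hdk hm hmk h)

/-- A path of even length `k - 1` can be extended at a source endpoint. -/
theorem exists_outPath_of_odd (hor : IsOriented D) (hd : ∀ v w, D v w → d ≤ #(outNbrs D v))
    {m : ℕ} (hdk : 3 * (m + 1) ≤ 4 * d + 2) (hm : 1 ≤ m) (he : Even m)
    (h : ∃ f, OutPath D m f) : ∃ g, OutPath (flip D) (m + 1) g := by
  by_contra! hno
  obtain ⟨f₀, h₀⟩ := h
  obtain ⟨f, hf, X, hXi, -, -, h1, h2, h3⟩ := exists_rotation_maximal hor hd hm h₀ hno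
  obtain ⟨n, rfl⟩ := he
  rw [hf.card_sources] at h2 h3
  rw [hf.card_sinks] at h1 h3
  obtain ⟨hXc, hX⟩ := h3 (by lia)
  have hend := hf.reverse_even ⟨n, rfl⟩
  have hXs : ∀ x ∈ X, D x (f (n + n)) := by
    intro x hx
    refine (hX x hx).2 _ (mem_sources.2 ⟨_, le_rfl, ⟨n, rfl⟩, rfl⟩) fun hm' => ?_
    obtain ⟨i, hi, -, e⟩ := hXi _ hm'
    have := hf.1 (Set.mem_Iic.2 hi.le) (Set.mem_Iic.2 le_rfl) e
    lia
  classical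
  have hXsub : X ⊆ sources (n + n) f := fun x hx => by
    obtain ⟨i, hi, he, e⟩ := hXi x hx
    exact mem_sources.2 ⟨i, hi.le, he, e⟩
  have hXeq : ∀ y ∈ sources (n + n) f, y ∉ X → y = f (n + n) := by
    have hc : #(sources (n + n) f \ X) ≤ 1 := by
      rw [card_sdiff_of_subset hXsub, hf.card_sources]
      lia
    intro y hy hyX
    refine card_le_one.1 hc y (mem_sdiff.2 ⟨hy, hyX⟩) _
      (mem_sdiff.2 ⟨mem_sources.2 ⟨_, le_rfl, ⟨n, rfl⟩, rfl⟩, fun hh => ?_⟩)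
    exact hor _ _ (hXs _ hh) (hXs _ hh)
  have hsub : outNbrs D (f (n + n)) ⊆ sinks (n + n) f := by
    intro y hy
    rw [mem_outNbrs] at hy
    have hy' : y ∈ sources (n + n) f ∨ y ∈ sinks (n + n) f := by
      by_contra! hc
      refine hno _ (hend.cons (x := y) ?_ (by simpa using hy))
      rintro i hi rfl
      by_cases he : Even (n + n - i)
      · exact hc.1 (mem_sources.2 ⟨_, by lia, he, rfl⟩)
      · exact hc.2 (mem_sinks.2 ⟨_, by lia, he, rfl⟩)
    refine hy'.resolve_left fun hs => ?_
    by_cases hyX : y ∈ X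
    · exact hor _ _ hy (hXs y hyX)
    · have := hXeq y hs hyX
      rw [this] at hy
      exact hor _ _ hy hy
  have h4 := card_le_card hsub
  rw [hf.card_sinks] at h4
  have h5 := hd _ _ (hf.2 (n + n) (n + n - 1) (by lia) (by lia) ⟨n, rfl⟩ (by lia))
  lia

/-- A path of odd length `k - 1` yields one of length `k` with both endpoints sinks. -/
theorem exists_outPath_of_even (hor : IsOriented D) (hd : ∀ v w, D v w → d ≤ #(outNbrs D v))
    (hd' : ∀ v w, flip D v w → d ≤ #(outNbrs (flip D) v))
    {m : ℕ} (hdk : 3 * (m + 1) ≤ 4 * d + 2) (hm : 2 ≤ m) (he : ¬ Even m)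
    (h : ∃ f, OutPath D m f) : ∃ g, OutPath (flip D) (m + 1) g := by
  by_contra! hno
  obtain ⟨f₀, h₀⟩ := h
  obtain ⟨f, hf, X, hXi, hN, -, h1, h2, h3⟩ :=
    exists_rotation_maximal hor hd (by lia) h₀ hno
  obtain ⟨n, rfl⟩ : ∃ n, m = 2 * n + 1 := Nat.not_even_iff_odd.1 he
  have hA := hf.card_sources
  have hB := hf.card_sinks
  have hdisj : Disjoint (sources (2 * n + 1) f) (sinks (2 * n + 1) f) :=
    disjoint_left.2 fun x hx => hf.notMem_sinks hx
  rw [hA] at h2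
  rw [hB] at h1
  rw [hA, hB] at h3
  obtain ⟨hXc, hX⟩ := h3 (by lia)
  have hXsub : X ⊆ sources (2 * n + 1) f := fun x hx => by
    obtain ⟨i, hi, he, e⟩ := hXi x hx
    exact mem_sources.2 ⟨i, hi.le, he, e⟩
  obtain rfl : X = sources (2 * n + 1) f := eq_of_subset_of_card_le hXsub (by lia)
  generalize sources (2 * n + 1) f = A at *
  generalize sinks (2 * n + 1) f = B at *
  have hcomp : ∀ a ∈ A, ∀ b ∈ B, D a b := fun a ha => (hX a ha).1
  have hexists : ∀ {E : V → V → Prop} {S : Finset V} {v : V}, #S < #(outNbrs E v) →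
      ∃ w, E v w ∧ w ∉ S := by
    intro E S v hlt
    obtain ⟨w, hw, hw'⟩ := exists_mem_notMem_of_card_lt_card hlt
    exact ⟨w, mem_outNbrs.1 hw, hw'⟩
  classical
  obtain ⟨a₁, ha₁⟩ : A.Nonempty := card_pos.1 (by lia)
  obtain ⟨b₀, hb₀⟩ : B.Nonempty := card_pos.1 (by lia)
  obtain ⟨a, ha₁a, haB⟩ := hexists (E := D) (S := B) (v := a₁)
    (by have := hd _ _ (hcomp a₁ ha₁ b₀ hb₀); lia)
  have ha : a ∈ A := (hN a₁ ha₁ a ha₁a).resolve_right haB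
  have hne : a ≠ a₁ := fun e => by rw [e] at ha₁a; exact hor _ _ ha₁a ha₁a
  obtain ⟨x, hxa, hxA⟩ := hexists (E := flip D) (S := A) (v := a)
    (by have := hd' a a₁ ha₁a; lia)
  change D x a at hxa
  have hxB : x ∉ B := fun hx => hor _ _ hxa (hcomp a ha x hx)
  have hax : a ≠ x := fun e => hxA (e ▸ ha)
  have hpa : OutPath D 1 _ :=
    (outPath_zero (flip D) a).cons (x := x) (fun _ _ => hax) hxa
  by_cases hb : ∃ b ∈ B, D x b
  · obtain ⟨b, hb, hxb⟩ := hb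
    have hp := hpa.cons (x := b) (by
      rintro (_ | i) _
      · exact (ne_of_mem_of_not_mem hb hxB).symm
      · exact (ne_of_mem_of_not_mem hb haB).symm) hxb
    obtain ⟨g, hg⟩ := OutPath.prolong (A := A.erase a) (B := B.erase b)
      (hdisj.mono (erase_subset _ _) (erase_subset _ _))
      (fun x hx y hy => hcomp x (mem_of_mem_erase hx) y (mem_of_mem_erase hy)) n
      (by rw [card_erase_of_mem ha]; lia) (by rw [card_erase_of_mem hb]; lia) hp
      (fun y hy => hcomp y (mem_of_mem_erase hy) b hb) (by
        have hbA : b ∉ A := fun h => disjoint_left.1 hdisj h hb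
        rintro (_ | _ | i) _ <;> simp [hbA, hxA, hxB, haB])
    exact hno g (by convert hg using 1; lia)
  · push Not at hb
    obtain ⟨z, hxz, hzA⟩ := hexists (E := D) (S := A) (v := x) (by have := hd _ _ hxa; lia)
    have hzB : z ∉ B := fun h => hb z h hxz
    have hzx : x ≠ z := fun e => by rw [e] at hxz; exact hor _ _ hxz hxz
    have hp1 := (outPath_zero (flip D) z).cons (x := x) (fun _ _ => hzx.symm) hxz
    have hp2 := hp1.cons (x := a) (by
      rintro (_ | i) _
      · exact hax.symm
      · exact (ne_of_mem_of_not_mem ha hzA).symm) hxa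
    have hp3 := hp2.cons (x := a₁) (by
      rintro (_ | _ | i) _
      · exact hne
      · exact (ne_of_mem_of_not_mem ha₁ hxA).symm
      · exact (ne_of_mem_of_not_mem ha₁ hzA).symm) ha₁a
    have hp4 := hp3.cons (x := b₀) (by
      rintro (_ | _ | _ | i) _
      · exact (ne_of_mem_of_not_mem hb₀ (disjoint_left.1 hdisj ha₁)).symm
      · exact (ne_of_mem_of_not_mem hb₀ haB).symm
      · exact (ne_of_mem_of_not_mem hb₀ hxB).symm
      · exact (ne_of_mem_of_not_mem hb₀ hzB).symm) (hcomp a₁ ha₁ b₀ hb₀)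
    obtain ⟨g, hg⟩ := OutPath.prolong (D := D) (A := (A.erase a).erase a₁) (B := B.erase b₀)
      (hdisj.mono ((erase_subset _ _).trans (erase_subset _ _)) (erase_subset _ _))
      (fun x hx y hy => hcomp x (mem_of_mem_erase (mem_of_mem_erase hx)) y
        (mem_of_mem_erase hy)) (n - 1)
      (by
        rw [card_erase_of_mem (mem_erase.2 ⟨hne.symm, ha₁⟩), card_erase_of_mem ha]
        lia)
      (by rw [card_erase_of_mem hb₀]; lia) hp4
      (fun y hy => hcomp y (mem_of_mem_erase (mem_of_mem_erase hy)) b₀ hb₀) (by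
        have hbA : b₀ ∉ A := fun h => disjoint_left.1 hdisj h hb₀
        have ha₁B := disjoint_left.1 hdisj ha₁
        rintro (_ | _ | _ | _ | i) _ <;> simp [hbA, ha₁B, hxA, hxB, haB, hzA, hzB])
    exact hno g (by convert hg using 1; lia)

end Counting

/-- Theorem 2: for `k ≥ 3`, every oriented graph of minimum pseudo-semidegree at least
`(3k-2)/4` contains every antidirected path of length `k`. -/
theorem stmt_7 {V : Type*} [Fintype V] (D : V → V → Prop) (hor : IsOriented D)
    (k : ℕ) (hk : 3 ≤ k) (hps : PseudoGE D ((3 * (k : ℝ) - 2) / 4)) :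
    ContainsAllAntipaths D k := by
  obtain ⟨hedge, hdeg⟩ := hps
  set d := ⌈(3 * (k : ℝ) - 2) / 4⌉₊ with hdef
  have hdk : 3 * k ≤ 4 * d + 2 := by
    have h := Nat.le_ceil ((3 * (k : ℝ) - 2) / 4)
    rw [← hdef] at h
    have : 3 * (k : ℝ) ≤ 4 * d + 2 := by linarith
    exact_mod_cast this
  have hd : ∀ v w, D v w → d ≤ #(outNbrs D v) := by
    intro v w hvw
    have hpos : 0 < #(outNbrs D v) := card_pos.2 ⟨w, mem_outNbrs.2 hvw⟩
    rw [card_outNbrs] at hpos ⊢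
    exact Nat.ceil_le.2 ((hdeg v).1.resolve_left hpos.ne')
  have hd' : ∀ v w, flip D v w → d ≤ #(outNbrs (flip D) v) := by
    intro v w hvw
    have hpos : 0 < #(outNbrs (flip D) v) := card_pos.2 ⟨w, mem_outNbrs.2 hvw⟩
    rw [card_outNbrs] at hpos ⊢
    exact Nat.ceil_le.2 ((hdeg v).2.resolve_left hpos.ne')
  obtain ⟨m, rfl⟩ : ∃ m, k = m + 1 := ⟨k - 1, by lia⟩
  have hpath := exists_outPath_of_lt hor hd hd' hdk hedge (m := m) (by lia) (by lia)
  have hboth : (∃ f, OutPath D (m + 1) f) ∧ ∃ f, OutPath (flip D) (m + 1) f := by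
    by_cases he : Even m
    · have ho : ¬ Even (m + 1) := by simpa [Nat.even_add_one] using he
      rcases hpath with h | h
      · obtain ⟨g, hg⟩ := exists_outPath_of_odd hor hd hdk (by lia) he h
        exact ⟨⟨_, hg.reverse_odd ho⟩, g, hg⟩
      · obtain ⟨g, hg⟩ := exists_outPath_of_odd hor.reverse hd' hdk (by lia) he h
        exact ⟨⟨g, hg⟩, _, OutPath.reverse_odd hg ho⟩
    · have hD : ∃ f, OutPath D m f :=
        hpath.elim id fun ⟨f, hf⟩ => ⟨_, hf.reverse_odd he⟩
      have hD' : ∃ f, OutPath (flip D) m f :=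
        hpath.elim (fun ⟨f, hf⟩ => ⟨_, hf.reverse_odd he⟩) id
      exact ⟨exists_outPath_of_even hor.reverse hd' hd hdk (by lia) he hD',
        exists_outPath_of_even hor hd hd' hdk (by lia) he hD⟩
  obtain ⟨⟨f, hf⟩, f', hf'⟩ := hboth
  intro b
  cases b
  · exact hf'.isAntipath_flip
  · exact hf.isAntipath
end
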